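/- Let f ∈ C¹(Ω; ℍ(ℂ)) where Ω ⊆ ℝ³ is open, let (r,θ,ψ) with r > 0, 0 < θ < π be such that the spherical point Φ(r,θ,ψ) ∈ Ω, and let F₀,F₁,F₂,F₃ denote the spherical component functions of f. Then D_MT[f](Φ(r,θ,ψ)) = −{∂F₁/∂r + (2/r)F₁ + (1/r)∂F₂/∂θ + (cot θ/r)F₂ + (1/(r sin θ))∂F₃/∂ψ} + {∂F₀/∂r + (1/r)∂F₃/∂θ + (cot θ/r)F₃ − (1/(r sin θ))∂F₂/∂ψ}u₁ + {(1/r)∂F₀/∂θ + (1/(r sin θ))∂F₁/∂ψ − ∂F₃/∂r − (1/r)F₃}u₂ + {(1/(r sin θ))∂F₀/∂ψ + ∂F₂/∂r + (1/r)F₂ − (1/r)∂F₁/∂θ}u₃, all quantities evaluated at (r,θ,ψ). -/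

import Mathlib

open Quaternion

noncomputable section

/-- Points of `ℝ³`. -/
abbrev P3 := Fin 3 → ℝ
/-- Vectors of `ℂ³`. -/
abbrev V3 := Fin 3 → ℂ

/-- Partial derivative `∂g/∂qᵢ` of a complex-valued function on `ℝ³`. -/
def pd (i : Fin 3) (g : P3 → ℂ) : P3 → ℂ := fun p => fderiv ℝ g p (Pi.single i 1)

/-- Gradient of a scalar field, extended ℂ-linearly. -/
def grad (g : P3 → ℂ) : P3 → V3 := fun p => ![pd 0 g p, pd 1 g p, pd 2 g p]

/-- Divergence of a `ℂ³`-valued vector field. -/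
def div3 (F : P3 → V3) : P3 → ℂ := fun p =>
  pd 0 (fun q => F q 0) p + pd 1 (fun q => F q 1) p + pd 2 (fun q => F q 2) p

/-- Curl of a `ℂ³`-valued vector field. -/
def curl (F : P3 → V3) : P3 → V3 := fun p =>
  ![pd 1 (fun q => F q 2) p - pd 2 (fun q => F q 1) p,
    pd 2 (fun q => F q 0) p - pd 0 (fun q => F q 2) p,
    pd 0 (fun q => F q 1) p - pd 1 (fun q => F q 0) p]

/-- Scalar Laplacian `∂²/∂x² + ∂²/∂y² + ∂²/∂z²` of a complex-valued function. -/
def lap (g : P3 → ℂ) : P3 → ℂ := fun p =>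
  pd 0 (pd 0 g) p + pd 1 (pd 1 g) p + pd 2 (pd 2 g) p

/-- A `ℂ³`-valued field is `Cⁿ` on a set iff each component is. -/
def VContDiffOn (n : ℕ) (F : P3 → V3) (Ω : Set P3) : Prop :=
  ∀ i : Fin 3, ContDiffOn ℝ n (fun q => F q i) Ω

/-- The quaternionic imaginary unit `i₁`. -/
def qi : ℍ[ℂ] := ⟨0, 1, 0, 0⟩
/-- The quaternionic imaginary unit `i₂`. -/
def qj : ℍ[ℂ] := ⟨0, 0, 1, 0⟩
/-- The quaternionic imaginary unit `i₃`. -/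
def qk : ℍ[ℂ] := ⟨0, 0, 0, 1⟩

/-- The complex quaternion with scalar part `s` and vector part `v ∈ ℂ³`. -/
def mkQ (s : ℂ) (v : V3) : ℍ[ℂ] := ⟨s, v 0, v 1, v 2⟩

/-- Scalar part of a complex quaternion. -/
def scQ (a : ℍ[ℂ]) : ℂ := a.re
/-- Vector part of a complex quaternion, identified with a vector in `ℂ³`. -/
def vecQ (a : ℍ[ℂ]) : V3 := ![a.imI, a.imJ, a.imK]

/-- Partial derivative `∂f/∂qᵢ` of an `ℍ(ℂ)`-valued function on `ℝ³`
(computed, as usual for vector-valued functions, componentwise). -/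
def qpd (i : Fin 3) (f : P3 → ℍ[ℂ]) : P3 → ℍ[ℂ] := fun p =>
  ⟨pd i (fun q => (f q).re) p, pd i (fun q => (f q).imI) p,
   pd i (fun q => (f q).imJ) p, pd i (fun q => (f q).imK) p⟩

/-- The Moisil–Theodoresco operator `D_MT[f] = i₁ ∂f/∂x + i₂ ∂f/∂y + i₃ ∂f/∂z`
(quaternionic multiplication on the left). -/
def DMT (f : P3 → ℍ[ℂ]) : P3 → ℍ[ℂ] := fun p =>
  qi * qpd 0 f p + qj * qpd 1 f p + qk * qpd 2 f p

/-- The right Moisil–Theodoresco operator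
`D^r_MT[f] = (∂f/∂x) i₁ + (∂f/∂y) i₂ + (∂f/∂z) i₃`. -/
def DMTr (f : P3 → ℍ[ℂ]) : P3 → ℍ[ℂ] := fun p =>
  qpd 0 f p * qi + qpd 1 f p * qj + qpd 2 f p * qk

/-- An `ℍ(ℂ)`-valued function is `Cⁿ` on a set iff each of its four
complex component functions is. -/
def QContDiffOn (n : ℕ) (f : P3 → ℍ[ℂ]) (Ω : Set P3) : Prop :=
  ContDiffOn ℝ n (fun q => (f q).re) Ω ∧ ContDiffOn ℝ n (fun q => (f q).imI) Ω ∧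
    ContDiffOn ℝ n (fun q => (f q).imJ) Ω ∧ ContDiffOn ℝ n (fun q => (f q).imK) Ω

/-- The scalar part `f₀` of an `ℍ(ℂ)`-valued function. -/
def sc (f : P3 → ℍ[ℂ]) : P3 → ℂ := fun q => (f q).re
/-- The vector part `f⃗` of an `ℍ(ℂ)`-valued function, as a `ℂ³`-valued field. -/
def vf (f : P3 → ℍ[ℂ]) : P3 → V3 := fun q => vecQ (f q)

/-- A real vector of `ℝ³` viewed inside `ℂ³`. -/
def c3 (v : P3) : V3 := fun i => (v i : ℂ)

/-- Spherical coordinate map `Φ(r,θ,ψ) = (r sin θ cos ψ, r sin θ sin ψ, r cos θ)`. -/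
def sphMap (p : P3) : P3 :=
  ![p 0 * Real.sin (p 1) * Real.cos (p 2),
    p 0 * Real.sin (p 1) * Real.sin (p 2),
    p 0 * Real.cos (p 1)]

/-- Spherical frame vector `u₁ = (sin θ cos ψ, sin θ sin ψ, cos θ)`, in `ℂ³`. -/
def sphU1 (p : P3) : V3 :=
  c3 ![Real.sin (p 1) * Real.cos (p 2), Real.sin (p 1) * Real.sin (p 2), Real.cos (p 1)]

/-- Spherical frame vector `u₂ = (cos θ cos ψ, cos θ sin ψ, −sin θ)`, in `ℂ³`. -/
def sphU2 (p : P3) : V3 :=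
  c3 ![Real.cos (p 1) * Real.cos (p 2), Real.cos (p 1) * Real.sin (p 2), -Real.sin (p 1)]

/-- Spherical frame vector `u₃ = (−sin ψ, cos ψ, 0)`, in `ℂ³`. -/
def sphU3 (p : P3) : V3 := c3 ![-Real.sin (p 2), Real.cos (p 2), 0]

/-- The radius `r`, as a complex number. -/
def rC (p : P3) : ℂ := ((p 0 : ℝ) : ℂ)
/-- `sin θ`, as a complex number. -/
def sinC (p : P3) : ℂ := ((Real.sin (p 1) : ℝ) : ℂ)
/-- `cot θ`, as a complex number. -/
def cotC (p : P3) : ℂ := ((Real.cos (p 1) / Real.sin (p 1) : ℝ) : ℂ)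

theorem pd_congr {g h : P3 → ℂ} {q : P3} (hgh : g =ᶠ[nhds q] h) (i : Fin 3) :
    pd i g q = pd i h q := by
  simp only [pd, hgh.fderiv_eq]

theorem pd_add {g h : P3 → ℂ} {q : P3} (hg : DifferentiableAt ℝ g q)
    (hh : DifferentiableAt ℝ h q) (i : Fin 3) :
    pd i (fun p => g p + h p) q = pd i g q + pd i h q := by
  simp [pd, fderiv_fun_add hg hh]

theorem pd_mul {g h : P3 → ℂ} {q : P3} (hg : DifferentiableAt ℝ g q)
    (hh : DifferentiableAt ℝ h q) (i : Fin 3) :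
    pd i (fun p => g p * h p) q = pd i g q * h q + g q * pd i h q := by
  simp only [pd, fderiv_fun_mul hg hh, add_apply, smul_apply,
    smul_eq_mul]
  ring

theorem pd_neg (g : P3 → ℂ) (q : P3) (i : Fin 3) :
    pd i (fun p => -g p) q = -pd i g q := by
  simp [pd, fderiv_fun_neg]

theorem hasFDerivAt_ofReal_coord {φ : ℝ → ℝ} {φ' : ℝ} {q : P3} {j : Fin 3}
    (h : HasDerivAt φ φ' (q j)) :
    HasFDerivAt (fun p : P3 => ((φ (p j) : ℝ) : ℂ))
      ((ContinuousLinearMap.proj (R := ℝ) (φ := fun _ : Fin 3 => ℝ) j).smulRight (φ' : ℂ)) q := by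
  have hj : HasFDerivAt (fun p : P3 => p j)
    (ContinuousLinearMap.proj (R := ℝ) (φ := fun _ : Fin 3 => ℝ) j) q := hasFDerivAt_apply j q
  have hL : (ContinuousLinearMap.proj (R := ℝ) (φ := fun _ : Fin 3 => ℝ) j).smulRight (φ' : ℂ) =
      (ContinuousLinearMap.toSpanSingleton ℝ (φ' : ℂ)).comp (ContinuousLinearMap.proj j) := by
    ext
    simp
  rw [hL]
  exact h.ofReal_comp.hasFDerivAt.comp q hj

theorem pd_ofReal_coord {φ : ℝ → ℝ} {φ' : ℝ} {q : P3} {j : Fin 3}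
    (h : HasDerivAt φ φ' (q j)) (i : Fin 3) :
    pd i (fun p => ((φ (p j) : ℝ) : ℂ)) q = if j = i then (φ' : ℂ) else 0 := by
  rw [pd, (hasFDerivAt_ofReal_coord h).fderiv]
  simp [Pi.single_apply]

theorem pd_sin (q : P3) (i j : Fin 3) :
    pd i (fun p => ((Real.sin (p j) : ℝ) : ℂ)) q =
      if j = i then ((Real.cos (q j) : ℝ) : ℂ) else 0 :=
  pd_ofReal_coord (Real.hasDerivAt_sin _) i

theorem pd_cos (q : P3) (i j : Fin 3) :
    pd i (fun p => ((Real.cos (p j) : ℝ) : ℂ)) q =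
      if j = i then -((Real.sin (q j) : ℝ) : ℂ) else 0 := by
  simpa using pd_ofReal_coord (Real.hasDerivAt_cos (q j)) i

theorem differentiableAt_sin_coord (q : P3) (j : Fin 3) :
    DifferentiableAt ℝ (fun p : P3 => ((Real.sin (p j) : ℝ) : ℂ)) q :=
  (hasFDerivAt_ofReal_coord (Real.hasDerivAt_sin _)).differentiableAt

theorem differentiableAt_cos_coord (q : P3) (j : Fin 3) :
    DifferentiableAt ℝ (fun p : P3 => ((Real.cos (p j) : ℝ) : ℂ)) q :=
  (hasFDerivAt_ofReal_coord (Real.hasDerivAt_cos _)).differentiableAt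

theorem differentiableAt_sphU1 (q : P3) (j : Fin 3) :
    DifferentiableAt ℝ (fun p => sphU1 p j) q := by
  have hs := differentiableAt_sin_coord q
  have hc := differentiableAt_cos_coord q
  fin_cases j
  · simpa only [sphU1, c3, Fin.zero_eta, Matrix.cons_val, Complex.ofReal_mul] using
      (hs 1).fun_mul (hc 2)
  · simpa only [sphU1, c3, Fin.mk_one, Matrix.cons_val, Complex.ofReal_mul] using
      (hs 1).fun_mul (hs 2)
  · simpa only [sphU1, c3, Fin.reduceFinMk, Matrix.cons_val] using hc 1

theorem differentiableAt_sphU2 (q : P3) (j : Fin 3) :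
    DifferentiableAt ℝ (fun p => sphU2 p j) q := by
  have hs := differentiableAt_sin_coord q
  have hc := differentiableAt_cos_coord q
  fin_cases j
  · simpa only [sphU2, c3, Fin.zero_eta, Matrix.cons_val, Complex.ofReal_mul] using
      (hc 1).fun_mul (hc 2)
  · simpa only [sphU2, c3, Fin.mk_one, Matrix.cons_val, Complex.ofReal_mul] using
      (hc 1).fun_mul (hs 2)
  · simpa only [sphU2, c3, Fin.reduceFinMk, Matrix.cons_val, Complex.ofReal_neg] using
      (hs 1).fun_neg

theorem differentiableAt_sphU3 (q : P3) (j : Fin 3) :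
    DifferentiableAt ℝ (fun p => sphU3 p j) q := by
  fin_cases j
  · simpa only [sphU3, c3, Fin.zero_eta, Matrix.cons_val, Complex.ofReal_neg] using
      (differentiableAt_sin_coord q 2).fun_neg
  · simpa only [sphU3, c3, Fin.mk_one, Matrix.cons_val] using differentiableAt_cos_coord q 2
  · simp [sphU3, c3]

theorem pd_sphU1 (q : P3) (i j : Fin 3) :
    pd i (fun p => sphU1 p j) q = ![0, sphU2 q j, sinC q * sphU3 q j] i := by
  have hs := differentiableAt_sin_coord q
  have hc := differentiableAt_cos_coord q
  fin_cases j <;>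
  simp only [sphU1, sphU2, sphU3, sinC, c3, Fin.zero_eta, Fin.mk_one, Fin.reduceFinMk,
    Matrix.cons_val, Complex.ofReal_mul, Complex.ofReal_neg, Complex.ofReal_zero,
    pd_mul (hs 1) (hc 2), pd_mul (hs 1) (hs 2), pd_sin, pd_cos] <;>
  fin_cases i <;> simp

theorem pd_sphU2 (q : P3) (i j : Fin 3) :
    pd i (fun p => sphU2 p j) q =
      ![0, -sphU1 q j, ((Real.cos (q 1) : ℝ) : ℂ) * sphU3 q j] i := by
  have hs := differentiableAt_sin_coord q
  have hc := differentiableAt_cos_coord q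
  fin_cases j <;>
  simp only [sphU1, sphU2, sphU3, c3, Fin.zero_eta, Fin.mk_one, Fin.reduceFinMk,
    Matrix.cons_val, Complex.ofReal_mul, Complex.ofReal_neg, Complex.ofReal_zero,
    pd_mul (hc 1) (hc 2), pd_mul (hc 1) (hs 2), pd_neg, pd_sin, pd_cos] <;>
  fin_cases i <;> simp

theorem pd_sphU3 (q : P3) (i j : Fin 3) :
    pd i (fun p => sphU3 p j) q = ![0, 0,
      ![-((Real.cos (q 2) : ℝ) : ℂ), -((Real.sin (q 2) : ℝ) : ℂ), 0] j] i := by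
  fin_cases j <;>
  simp only [sphU3, c3, Fin.zero_eta, Fin.mk_one, Fin.reduceFinMk, Matrix.cons_val,
    Complex.ofReal_neg, Complex.ofReal_zero, pd_neg, pd_sin, pd_cos] <;>
  fin_cases i <;> simp [pd]

/-- Leibniz rule for the component of a vector field along a moving frame vector. -/
theorem pd_dot {U : P3 → V3} {a b c : P3 → ℂ} {q : P3}
    (hU : ∀ j, DifferentiableAt ℝ (fun p => U p j) q) (ha : DifferentiableAt ℝ a q)
    (hb : DifferentiableAt ℝ b q) (hc : DifferentiableAt ℝ c q) (i : Fin 3) :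
    pd i (fun p => U p 0 * a p + U p 1 * b p + U p 2 * c p) q =
      pd i (fun p => U p 0) q * a q + U q 0 * pd i a q +
      (pd i (fun p => U p 1) q * b q + U q 1 * pd i b q) +
      (pd i (fun p => U p 2) q * c q + U q 2 * pd i c q) := by
  rw [pd_add (((hU 0).fun_mul ha).fun_add ((hU 1).fun_mul hb)) ((hU 2).fun_mul hc),
    pd_add ((hU 0).fun_mul ha) ((hU 1).fun_mul hb), pd_mul (hU 0) ha, pd_mul (hU 1) hb,
    pd_mul (hU 2) hc]

theorem differentiable_sphMap : Differentiable ℝ sphMap := by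
  refine differentiable_pi.2 fun j => ?_
  fin_cases j <;> simp [sphMap] <;> fun_prop

theorem fderiv_apply_eq_sum_pd (g : P3 → ℂ) (p v : P3) :
    fderiv ℝ g p v = v 0 * pd 0 g p + v 1 * pd 1 g p + v 2 * pd 2 g p := by
  have hv : v = v 0 • Pi.single 0 1 + v 1 • Pi.single 1 1 + v 2 • Pi.single 2 1 := by
    ext j; fin_cases j <;> simp
  conv_lhs => rw [hv]
  simp [pd]

/-- Chain rule along a coordinate line of the spherical map. -/
theorem pd_comp_sphMap {g : P3 → ℂ} {q : P3} (hg : DifferentiableAt ℝ g (sphMap q))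
    {i : Fin 3} {v : P3}
    (hv : HasDerivAt (fun t => sphMap (Function.update q i t)) v (q i)) :
    pd i (fun p => g (sphMap p)) q =
      v 0 * pd 0 g (sphMap q) + v 1 * pd 1 g (sphMap q) + v 2 * pd 2 g (sphMap q) := by
  have hv' : HasDerivAt (fun t => sphMap (Function.update q i t))
      (fderiv ℝ sphMap q (Pi.single i 1)) (q i) := by
    have h := (differentiable_sphMap (Function.update q i (q i))).hasFDerivAt.comp_hasDerivAt (q i)
      (hasDerivAt_update q i (q i))
    rwa [Function.update_eq_self] at h
  rw [← fderiv_apply_eq_sum_pd, hv.unique hv', pd,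
    show (fun p => g (sphMap p)) = g ∘ sphMap from rfl,
    fderiv_comp q hg (differentiable_sphMap q)]
  rfl

theorem pd_zero_comp_sphMap {g : P3 → ℂ} {q : P3} (hg : DifferentiableAt ℝ g (sphMap q)) :
    pd 0 (fun p => g (sphMap p)) q =
      sphU1 q 0 * pd 0 g (sphMap q) + sphU1 q 1 * pd 1 g (sphMap q) +
        sphU1 q 2 * pd 2 g (sphMap q) := by
  refine pd_comp_sphMap hg (v := ![_, _, _]) (hasDerivAt_pi.2 fun j => ?_)
  fin_cases j
  · simpa [sphMap, mul_assoc] using (hasDerivAt_id (q 0)).mul_const (Real.sin (q 1) * Real.cos (q 2))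
  · simpa [sphMap, mul_assoc] using (hasDerivAt_id (q 0)).mul_const (Real.sin (q 1) * Real.sin (q 2))
  · simpa [sphMap] using (hasDerivAt_id (q 0)).mul_const (Real.cos (q 1))

theorem pd_one_comp_sphMap {g : P3 → ℂ} {q : P3} (hg : DifferentiableAt ℝ g (sphMap q)) :
    pd 1 (fun p => g (sphMap p)) q =
      rC q * (sphU2 q 0 * pd 0 g (sphMap q) + sphU2 q 1 * pd 1 g (sphMap q) +
        sphU2 q 2 * pd 2 g (sphMap q)) := by
  rw [pd_comp_sphMap hg (v := ![q 0 * Real.cos (q 1) * Real.cos (q 2),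
    q 0 * Real.cos (q 1) * Real.sin (q 2), q 0 * -Real.sin (q 1)]) (hasDerivAt_pi.2 fun j => ?_)]
  · simp [sphU2, c3, rC]; ring
  · fin_cases j
    · simpa [sphMap] using
        ((Real.hasDerivAt_sin (q 1)).const_mul (q 0)).mul_const (Real.cos (q 2))
    · simpa [sphMap] using
        ((Real.hasDerivAt_sin (q 1)).const_mul (q 0)).mul_const (Real.sin (q 2))
    · simpa [sphMap] using (Real.hasDerivAt_cos (q 1)).const_mul (q 0)

theorem pd_two_comp_sphMap {g : P3 → ℂ} {q : P3} (hg : DifferentiableAt ℝ g (sphMap q)) :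
    pd 2 (fun p => g (sphMap p)) q =
      rC q * sinC q * (sphU3 q 0 * pd 0 g (sphMap q) + sphU3 q 1 * pd 1 g (sphMap q)) := by
  rw [pd_comp_sphMap hg (v := ![q 0 * Real.sin (q 1) * -Real.sin (q 2),
    q 0 * Real.sin (q 1) * Real.cos (q 2), 0]) (hasDerivAt_pi.2 fun j => ?_)]
  · simp [sphU3, c3, rC, sinC]; ring
  · fin_cases j
    · simpa [sphMap] using (Real.hasDerivAt_cos (q 2)).const_mul (q 0 * Real.sin (q 1))
    · simpa [sphMap] using (Real.hasDerivAt_sin (q 2)).const_mul (q 0 * Real.sin (q 1))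
    · simpa [sphMap] using hasDerivAt_const (q 2) (q 0 * Real.cos (q 1))

theorem DMT_eq (f : P3 → ℍ[ℂ]) (p : P3) :
    DMT f p = mkQ (-div3 (vf f) p) (grad (sc f) p + curl (vf f) p) := by
  have hsc : (fun q => (f q).re) = sc f := rfl
  ext <;>
  simp only [DMT, Quaternion.re_add, Quaternion.imI_add, Quaternion.imJ_add, Quaternion.imK_add,
    Quaternion.re_mul, Quaternion.imI_mul, Quaternion.imJ_mul, Quaternion.imK_mul] <;>
  simp [qi, qj, qk, qpd, mkQ, div3, grad, curl, vf, vecQ, hsc] <;> ring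

theorem ofReal_sin_sq_add_cos_sq (x : ℝ) :
    ((Real.sin x : ℝ) : ℂ) ^ 2 + ((Real.cos x : ℝ) : ℂ) ^ 2 = 1 := by
  exact_mod_cast Real.sin_sq_add_cos_sq x

/-- The spherical components are recovered by projecting onto the orthonormal frame. -/
theorem spherical_components {a : ℍ[ℂ]} {p : P3} {x₀ x₁ x₂ x₃ : ℂ}
    (h : a = mkQ x₀ (x₁ • sphU1 p + x₂ • sphU2 p + x₃ • sphU3 p)) :
    x₀ = a.re ∧
    x₁ = sphU1 p 0 * a.imI + sphU1 p 1 * a.imJ + sphU1 p 2 * a.imK ∧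
    x₂ = sphU2 p 0 * a.imI + sphU2 p 1 * a.imJ + sphU2 p 2 * a.imK ∧
    x₃ = sphU3 p 0 * a.imI + sphU3 p 1 * a.imJ + sphU3 p 2 * a.imK := by
  have h1 := ofReal_sin_sq_add_cos_sq (p 1)
  have h2 := ofReal_sin_sq_add_cos_sq (p 2)
  subst h
  simp only [mkQ, sphU1, sphU2, sphU3, c3, Pi.add_apply, Pi.smul_apply, smul_eq_mul,
    Matrix.cons_val, Complex.ofReal_mul, Complex.ofReal_neg, Complex.ofReal_zero]
  generalize ((Real.sin (p 1) : ℝ) : ℂ) = s at *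
  generalize ((Real.cos (p 1) : ℝ) : ℂ) = c at *
  generalize ((Real.sin (p 2) : ℝ) : ℂ) = S at *
  generalize ((Real.cos (p 2) : ℝ) : ℂ) = C at *
  refine ⟨trivial, ?_, ?_, ?_⟩ <;> grind

/-- For `f ∈ C¹(Ω; ℍ(ℂ))` with spherical component functions
`F₀, F₁, F₂, F₃` (so `(f∘Φ) = F₀ + F₁u₁ + F₂u₂ + F₃u₃` wherever `Φ(r,θ,ψ) ∈ Ω`),
and any `(r,θ,ψ)` with `r > 0`, `0 < θ < π` and `Φ(r,θ,ψ) ∈ Ω`, the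
Moisil–Theodoresco operator at `Φ(r,θ,ψ)` is given by the classical spherical
expression. -/
theorem DMT_spherical (Ω : Set P3) (hΩ : IsOpen Ω) (f : P3 → ℍ[ℂ])
    (hf : QContDiffOn 1 f Ω) (F₀ F₁ F₂ F₃ : P3 → ℂ)
    (hdec : ∀ p : P3, sphMap p ∈ Ω →
      f (sphMap p) = mkQ (F₀ p) (F₁ p • sphU1 p + F₂ p • sphU2 p + F₃ p • sphU3 p))
    (q : P3) (hr : 0 < q 0) (hθ₀ : 0 < q 1) (hθπ : q 1 < Real.pi)
    (hq : sphMap q ∈ Ω) :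
    DMT f (sphMap q) =
      mkQ
        (-(pd 0 F₁ q + (2 / rC q) * F₁ q + (1 / rC q) * pd 1 F₂ q +
            (cotC q / rC q) * F₂ q + (1 / (rC q * sinC q)) * pd 2 F₃ q))
        ((pd 0 F₀ q + (1 / rC q) * pd 1 F₃ q + (cotC q / rC q) * F₃ q -
            (1 / (rC q * sinC q)) * pd 2 F₂ q) • sphU1 q +
         ((1 / rC q) * pd 1 F₀ q + (1 / (rC q * sinC q)) * pd 2 F₁ q -
            pd 0 F₃ q - (1 / rC q) * F₃ q) • sphU2 q +
         ((1 / (rC q * sinC q)) * pd 2 F₀ q + pd 0 F₂ q + (1 / rC q) * F₂ q -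
            (1 / rC q) * pd 1 F₁ q) • sphU3 q) := by
  have hmem := hΩ.mem_nhds hq
  have d₀ := (hf.1.contDiffAt hmem).differentiableAt one_ne_zero
  have d₁ := (hf.2.1.contDiffAt hmem).differentiableAt one_ne_zero
  have d₂ := (hf.2.2.1.contDiffAt hmem).differentiableAt one_ne_zero
  have d₃ := (hf.2.2.2.contDiffAt hmem).differentiableAt one_ne_zero
  have e₁ : DifferentiableAt ℝ (fun p => (f (sphMap p)).imI) q :=
    d₁.comp q (differentiable_sphMap q)
  have e₂ : DifferentiableAt ℝ (fun p => (f (sphMap p)).imJ) q :=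
    d₂.comp q (differentiable_sphMap q)
  have e₃ : DifferentiableAt ℝ (fun p => (f (sphMap p)).imK) q :=
    d₃.comp q (differentiable_sphMap q)
  have hev : ∀ᶠ p in nhds q, sphMap p ∈ Ω :=
    (differentiable_sphMap q).continuousAt.eventually_mem hmem
  have hc := hev.mono fun p hp => spherical_components (hdec p hp)
  have h₀ : F₀ =ᶠ[nhds q] fun p => (f (sphMap p)).re := hc.mono fun p h => h.1
  have h₁ := hc.mono fun p h => h.2.1
  have h₂ := hc.mono fun p h => h.2.2.1
  have h₃ := hc.mono fun p h => h.2.2.2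
  have hr' : rC q ≠ 0 := Complex.ofReal_ne_zero.2 hr.ne'
  have hs' : sinC q ≠ 0 := Complex.ofReal_ne_zero.2 (Real.sin_pos_of_pos_of_lt_pi hθ₀ hθπ).ne'
  have t₁ := ofReal_sin_sq_add_cos_sq (q 1)
  have t₂ := ofReal_sin_sq_add_cos_sq (q 2)
  have hcot : cotC q = ((Real.cos (q 1) : ℝ) : ℂ) / sinC q := Complex.ofReal_div _ _
  simp only [pd_congr h₀, pd_congr h₁, pd_congr h₂, pd_congr h₃, h₁.self_of_nhds,
    h₂.self_of_nhds, h₃.self_of_nhds, pd_dot (differentiableAt_sphU1 q) e₁ e₂ e₃,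
    pd_dot (differentiableAt_sphU2 q) e₁ e₂ e₃, pd_dot (differentiableAt_sphU3 q) e₁ e₂ e₃,
    pd_sphU1, pd_sphU2, pd_sphU3, pd_zero_comp_sphMap d₀, pd_zero_comp_sphMap d₁,
    pd_zero_comp_sphMap d₂, pd_zero_comp_sphMap d₃, pd_one_comp_sphMap d₀,
    pd_one_comp_sphMap d₁, pd_one_comp_sphMap d₂, pd_one_comp_sphMap d₃,
    pd_two_comp_sphMap d₀, pd_two_comp_sphMap d₁, pd_two_comp_sphMap d₂,
    pd_two_comp_sphMap d₃, hcot]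
  have hsc : (fun q => (f q).re) = sc f := rfl
  have hsin : ((Real.sin (q 1) : ℝ) : ℂ) = sinC q := rfl
  simp only [DMT_eq, div3, grad, curl, vf, vecQ, mkQ, sphU1, sphU2, sphU3, c3, hsin, hsc, Pi.add_apply,
    Pi.smul_apply, smul_eq_mul, Matrix.cons_val, Complex.ofReal_mul, Complex.ofReal_neg,
    Complex.ofReal_zero] at t₁ ⊢
  generalize sinC q = s at *
  generalize rC q = r at *
  generalize ((Real.cos (q 1) : ℝ) : ℂ) = c at *
  generalize ((Real.sin (q 2) : ℝ) : ℂ) = S at *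
  generalize ((Real.cos (q 2) : ℝ) : ℂ) = C at *
  generalize pd 0 (sc f) (sphMap q) = a0 at *
  generalize pd 1 (sc f) (sphMap q) = a1 at *
  generalize pd 2 (sc f) (sphMap q) = a2 at *
  generalize pd 0 (fun q => (f q).imI) (sphMap q) = x0 at *
  generalize pd 1 (fun q => (f q).imI) (sphMap q) = x1 at *
  generalize pd 2 (fun q => (f q).imI) (sphMap q) = x2 at *
  generalize pd 0 (fun q => (f q).imJ) (sphMap q) = y0 at *
  generalize pd 1 (fun q => (f q).imJ) (sphMap q) = y1 at *
  generalize pd 2 (fun q => (f q).imJ) (sphMap q) = y2 at *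
  generalize pd 0 (fun q => (f q).imK) (sphMap q) = z0 at *
  generalize pd 1 (fun q => (f q).imK) (sphMap q) = z1 at *
  generalize pd 2 (fun q => (f q).imK) (sphMap q) = z2 at *
  ext <;> simp only <;> field_simp <;> grind
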